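/- arXiv:cs/0610054 — 3 statements merged into one kernel-verified Lean document; each statement's English description precedes it below -/
import Mathlib

section
/- For every natural number n, H₁(n) = Σ_{k=0}^{n} C(n,k) · H(k), where H₁(n) is the number of meet-closed subsets of Fin n → Bool containing the all-true vector, H(k) is the number of meet-closed subsets of Fin k → Bool containing both the all-false and the all-true vector, and C(n,k) is the binomial coefficient. -/
/-- A set of Boolean vectors is meet-closed if it is closed under
pointwise conjunction. -/
def MeetClosed {n : ℕ} (S : Set (Fin n → Bool)) : Prop :=
  ∀ v ∈ S, ∀ w ∈ S, (fun i => v i && w i) ∈ S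

/-- `H k` is the number of meet-closed subsets of `Fin k → Bool` containing
both the all-false and the all-true vector. -/
noncomputable def H (k : ℕ) : ℕ :=
  Nat.card {S : Set (Fin k → Bool) //
    MeetClosed S ∧ (fun _ => false) ∈ S ∧ (fun _ => true) ∈ S}

open Classical in
/-- The coordinates at which some member of `S` is false. -/
noncomputable def falseCoords {n : ℕ} (S : Set (Fin n → Bool)) : Finset (Fin n) :=
  {i | ∃ v ∈ S, v i = false}

theorem mem_falseCoords {n : ℕ} {S : Set (Fin n → Bool)} {i : Fin n} :
    i ∈ falseCoords S ↔ ∃ v ∈ S, v i = false := by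
  simp [falseCoords]

theorem eq_true_of_notMem_falseCoords {n : ℕ} {S : Set (Fin n → Bool)} {i : Fin n}
    (hi : i ∉ falseCoords S) {v : Fin n → Bool} (hv : v ∈ S) : v i = true := by
  by_contra h
  exact hi (mem_falseCoords.2 ⟨v, hv, by simpa using h⟩)

theorem MeetClosed.exists_forall_mem_eq_false {n : ℕ} {S : Set (Fin n → Bool)}
    (hS : MeetClosed S) (htop : (fun _ => true) ∈ S) {T : Finset (Fin n)}
    (hT : T ⊆ falseCoords S) : ∃ v ∈ S, ∀ i ∈ T, v i = false := by
  induction T using Finset.induction_on with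
  | empty => exact ⟨_, htop, by simp⟩
  | insert a T _ ih =>
    rw [Finset.insert_subset_iff] at hT
    obtain ⟨v, hv, hvT⟩ := ih hT.2
    obtain ⟨w, hw, hwa⟩ := mem_falseCoords.1 hT.1
    refine ⟨_, hS v hv w hw, fun i hi => ?_⟩
    rcases Finset.mem_insert.1 hi with rfl | hi
    · simp [hwa]
    · simp [hvT i hi]

/-- Extend a vector along `φ` by the value true. -/
noncomputable def extendTrue {k n : ℕ} (φ : Fin k ↪ Fin n) (u : Fin k → Bool) : Fin n → Bool :=
  Function.extend φ u fun _ => true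

theorem extendTrue_apply {k n : ℕ} (φ : Fin k ↪ Fin n) (u : Fin k → Bool) (j : Fin k) :
    extendTrue φ u (φ j) = u j :=
  φ.injective.extend_apply _ _ _

theorem extendTrue_of_notMem {k n : ℕ} (φ : Fin k ↪ Fin n) (u : Fin k → Bool) {i : Fin n}
    (hi : i ∉ Set.range φ) : extendTrue φ u i = true :=
  Function.extend_apply' _ _ _ hi

theorem extendTrue_eq {k n : ℕ} (φ : Fin k ↪ Fin n) {u : Fin k → Bool} {w : Fin n → Bool}
    (hw : ∀ i ∉ Set.range φ, w i = true) (hu : ∀ j, w (φ j) = u j) : extendTrue φ u = w := by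
  funext i
  by_cases hi : i ∈ Set.range φ
  · obtain ⟨j, rfl⟩ := hi
    rw [extendTrue_apply, hu]
  · rw [extendTrue_of_notMem φ u hi, hw i hi]

/-- Meet-closed families whose false coordinates are the range of `φ` correspond to
meet-closed families containing both constant vectors on the domain of `φ`. -/
noncomputable def fiberEquiv {k n : ℕ} (φ : Fin k ↪ Fin n) :
    {S : Set (Fin n → Bool) // (MeetClosed S ∧ (fun _ => true) ∈ S) ∧
      (falseCoords S : Set (Fin n)) = Set.range φ} ≃
    {S : Set (Fin k → Bool) //
      MeetClosed S ∧ (fun _ => false) ∈ S ∧ (fun _ => true) ∈ S} where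
  toFun S := ⟨{u | extendTrue φ u ∈ S.1}, by
    obtain ⟨S, ⟨hS, htop⟩, hφ⟩ := S
    refine ⟨fun v hv w hw => ?_, ?_, ?_⟩
    · have h : extendTrue φ (fun i => v i && w i) =
          fun i => extendTrue φ v i && extendTrue φ w i :=
        extendTrue_eq φ (fun i hi => by simp [extendTrue_of_notMem φ _ hi])
          fun j => by simp [extendTrue_apply]
      rw [Set.mem_ofPred_eq, h]
      exact hS _ hv _ hw
    · obtain ⟨v, hv, hvT⟩ := hS.exists_forall_mem_eq_false htop subset_rfl
      have h : extendTrue φ (fun _ => false) = v := by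
        refine extendTrue_eq φ (fun i hi => ?_) fun j => hvT _ ?_
        · rw [← hφ] at hi
          exact eq_true_of_notMem_falseCoords hi hv
        · rw [← Finset.mem_coe, hφ]
          exact ⟨j, rfl⟩
      simpa [h] using hv
    · have h : extendTrue φ (fun _ => true) = fun _ => true :=
        extendTrue_eq φ (fun _ _ => rfl) fun _ => rfl
      simpa [h] using htop⟩
  invFun S := ⟨{w | (∀ i ∉ Set.range φ, w i = true) ∧ (fun j => w (φ j)) ∈ S.1}, by
    obtain ⟨S, hS, hbot, htop⟩ := S
    refine ⟨⟨fun v hv w hw => ⟨fun i hi => ?_, hS _ hv.2 _ hw.2⟩, fun _ _ => rfl, htop⟩, ?_⟩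
    · simp [hv.1 i hi, hw.1 i hi]
    · ext i
      rw [Finset.mem_coe, mem_falseCoords]
      constructor
      · rintro ⟨v, hv, hvi⟩
        by_contra hi
        simp [hv.1 i hi] at hvi
      · rintro ⟨j, rfl⟩
        refine ⟨extendTrue φ fun _ => false,
          ⟨fun i hi => extendTrue_of_notMem φ _ hi, ?_⟩, extendTrue_apply φ _ j⟩
        simpa only [extendTrue_apply] using hbot⟩
  left_inv := by
    rintro ⟨S, ⟨hS, htop⟩, hφ⟩
    refine Subtype.ext (Set.ext fun w => ⟨fun ⟨h, hw⟩ => ?_, fun hw => ?_⟩)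
    · rwa [Set.mem_ofPred_eq, extendTrue_eq φ h fun _ => rfl] at hw
    · have h : ∀ i ∉ Set.range φ, w i = true := fun i hi => by
        rw [← hφ] at hi
        exact eq_true_of_notMem_falseCoords hi hw
      refine ⟨h, ?_⟩
      rwa [Set.mem_ofPred_eq, extendTrue_eq φ h fun _ => rfl]
  right_inv := by
    rintro ⟨S, hS⟩
    refine Subtype.ext (Set.ext fun u => ?_)
    simp only [Set.mem_ofPred_eq, extendTrue_apply]
    exact and_iff_right fun i hi => extendTrue_of_notMem φ u hi

theorem card_meetClosed_falseCoords_eq {n : ℕ} (T : Finset (Fin n)) :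
    Nat.card {S : {S : Set (Fin n → Bool) // MeetClosed S ∧ (fun _ => true) ∈ S} //
      falseCoords S.1 = T} = H T.card := by
  let φ : Fin T.card ↪ Fin n := (T.orderEmbOfFin rfl).toEmbedding
  have hφ : Set.range φ = T := T.range_orderEmbOfFin rfl
  refine Nat.card_congr ((Equiv.subtypeSubtypeEquivSubtypeInter _
    fun S => falseCoords S = T).trans ((Equiv.subtypeEquivRight fun S => ?_).trans (fiberEquiv φ)))
  rw [hφ, Finset.coe_inj]

theorem H1_eq_sum_choose_mul_H (n : ℕ) :
    Nat.card {S : Set (Fin n → Bool) //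
        MeetClosed S ∧ (fun _ => true) ∈ S} =
      ∑ k ∈ Finset.range (n + 1), n.choose k * H k := by
  rw [← Nat.card_congr (Equiv.sigmaFiberEquiv
    fun S : {S : Set (Fin n → Bool) // MeetClosed S ∧ (fun _ => true) ∈ S} => falseCoords S.1),
    Nat.card_sigma]
  simp_rw [card_meetClosed_falseCoords_eq]
  rw [← Finset.powerset_univ, Finset.sum_powerset_apply_card]
  simp
end

section
/- The number of meet-closed subsets of Fin 4 → Bool containing both the all-false vector and the all-true vector is 2271. (In the paper's notation: H(4) = 2271.) -/
/-- The set of positions of the one bits of `m` is closed under bitwise conjunction. -/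
def BitsLandClosed (m : ℕ) : Prop :=
  ∀ i j, m.testBit i = true → m.testBit j = true → m.testBit (i &&& j) = true

/-- Setting the bit `k` in a mask `m < 2 ^ k` keeps it closed under bitwise conjunction. -/
def canSetBit (m k : ℕ) : Bool :=
  (List.range k).all fun j => !m.testBit j || m.testBit (j &&& k)

/-- The masks below `2 ^ k` whose set of one bits is closed under bitwise conjunction. -/
def closedMasks : ℕ → List ℕ
  | 0 => [0]
  | k + 1 => closedMasks k ++ ((closedMasks k).filter (canSetBit · k)).map (2 ^ k + ·)

lemma canSetBit_iff {m k : ℕ} :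
    canSetBit m k = true ↔
      ∀ j < k, m.testBit j = true → m.testBit (j &&& k) = true := by
  simp only [canSetBit, List.all_eq_true, List.mem_range, Bool.or_eq_true,
    Bool.not_eq_true']
  refine forall₂_congr fun j _ => ?_
  cases m.testBit j <;> simp

lemma testBit_two_pow_add {m k : ℕ} (hm : m < 2 ^ k) (i : ℕ) :
    (2 ^ k + m).testBit i = (decide (k = i) || m.testBit i) := by
  have h := Nat.two_pow_add_eq_or_of_lt hm 1
  rw [mul_one] at h
  rw [h, Nat.testBit_or, Nat.testBit_two_pow]

lemma lt_of_testBit_of_lt_two_pow {m k i : ℕ} (hm : m < 2 ^ k) (hi : m.testBit i = true) :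
    i < k := by
  by_contra! h
  rw [Nat.testBit_lt_two_pow (hm.trans_le (Nat.pow_le_pow_right two_pos h))] at hi
  exact Bool.false_ne_true hi

lemma bitsLandClosed_two_pow_add_iff {m k : ℕ} (hm : m < 2 ^ k) :
    BitsLandClosed (2 ^ k + m) ↔ BitsLandClosed m ∧ canSetBit m k = true := by
  rw [canSetBit_iff]
  simp only [BitsLandClosed, testBit_two_pow_add hm, Bool.or_eq_true, decide_eq_true_eq]
  constructor
  · refine fun h => ⟨fun i j hi hj => ?_, fun j hjk hj => ?_⟩
    · have hik := lt_of_testBit_of_lt_two_pow hm hi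
      have hle : i &&& j ≤ i := Nat.and_le_left
      exact (h i j (.inr hi) (.inr hj)).resolve_left (by omega)
    · have hle : j &&& k ≤ j := Nat.and_le_left
      exact (h j k (.inr hj) (.inl rfl)).resolve_left (by omega)
  · rintro ⟨h, hk⟩ i j (rfl | hi) (rfl | hj)
    · simp
    · rw [Nat.and_comm]
      exact .inr (hk j (lt_of_testBit_of_lt_two_pow hm hj) hj)
    · exact .inr (hk i (lt_of_testBit_of_lt_two_pow hm hi) hi)
    · exact .inr (h i j hi hj)

lemma mem_closedMasks {k m : ℕ} : m ∈ closedMasks k ↔ m < 2 ^ k ∧ BitsLandClosed m := by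
  induction k generalizing m with
  | zero =>
    simp only [closedMasks, List.mem_singleton, pow_zero, Nat.lt_one_iff]
    exact ⟨by rintro rfl; simp [BitsLandClosed], And.left⟩
  | succ k ih =>
    simp only [closedMasks, List.mem_append, List.mem_map, List.mem_filter, ih]
    constructor
    · rintro (⟨hm, h⟩ | ⟨a, ⟨⟨ha, h⟩, hk⟩, rfl⟩)
      · exact ⟨by rw [pow_succ]; omega, h⟩
      · exact ⟨by rw [pow_succ]; omega, (bitsLandClosed_two_pow_add_iff ha).2 ⟨h, hk⟩⟩
    · rintro ⟨hm, h⟩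
      rcases lt_or_ge m (2 ^ k) with hlt | hge
      · exact .inl ⟨hlt, h⟩
      · obtain ⟨a, rfl⟩ := Nat.exists_eq_add_of_le hge
        have ha : a < 2 ^ k := by rw [pow_succ] at hm; omega
        obtain ⟨h₁, h₂⟩ := (bitsLandClosed_two_pow_add_iff ha).1 h
        exact .inr ⟨a, ⟨⟨ha, h₁⟩, h₂⟩, rfl⟩

lemma nodup_closedMasks (k : ℕ) : (closedMasks k).Nodup := by
  induction k with
  | zero => simp [closedMasks]
  | succ k ih =>
    refine ih.append ((ih.filter _).map (add_right_injective _)) fun m hm hm' => ?_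
    obtain ⟨a, -, rfl⟩ := List.mem_map.1 hm'
    have := (mem_closedMasks.1 hm).1
    omega

lemma ofBits_and {n : ℕ} (v w : Fin n → Bool) :
    Nat.ofBits (fun i => v i && w i) = Nat.ofBits v &&& Nat.ofBits w := by
  refine Nat.eq_of_testBit_eq fun i => ?_
  rw [Nat.testBit_and]
  rcases lt_or_ge i n with h | h
  · simp [Nat.testBit_ofBits_lt _ _ h]
  · simp [Nat.testBit_ofBits_ge _ _ h]

/-- The set of vectors whose binary codes are the positions of the one bits of `m`. -/
def vectorSet (n m : ℕ) : Set (Fin n → Bool) :=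
  {v | m.testBit (Nat.ofBits v) = true}

lemma mem_vectorSet {n m : ℕ} {v : Fin n → Bool} :
    v ∈ vectorSet n m ↔ m.testBit (Nat.ofBits v) = true :=
  Iff.rfl

lemma ofBits_testBit_of_lt {n c : ℕ} (hc : c < 2 ^ n) :
    Nat.ofBits (fun i : Fin n => c.testBit i) = c := by
  rw [Nat.ofBits_testBit, Nat.mod_eq_of_lt hc]

lemma meetClosed_vectorSet_iff {n m : ℕ} (hm : m < 2 ^ 2 ^ n) :
    MeetClosed (vectorSet n m) ↔ BitsLandClosed m := by
  simp only [MeetClosed, mem_vectorSet, ofBits_and]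
  refine ⟨fun h i j hi hj => ?_, fun h v hv w hw => h _ _ hv hw⟩
  have := h (fun x => i.testBit x) (by rwa [ofBits_testBit_of_lt
    (lt_of_testBit_of_lt_two_pow hm hi)]) (fun x => j.testBit x) (by rwa [ofBits_testBit_of_lt
    (lt_of_testBit_of_lt_two_pow hm hj)])
  rwa [ofBits_testBit_of_lt (lt_of_testBit_of_lt_two_pow hm hi),
    ofBits_testBit_of_lt (lt_of_testBit_of_lt_two_pow hm hj)] at this

lemma vectorSet_injOn (n : ℕ) : Set.InjOn (vectorSet n) {m | m < 2 ^ 2 ^ n} := by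
  intro a ha b hb hab
  refine Nat.eq_of_testBit_eq fun i => ?_
  rcases lt_or_ge i (2 ^ n) with hi | hi
  · have := Set.ext_iff.1 hab fun x => i.testBit x
    simpa only [mem_vectorSet, ofBits_testBit_of_lt hi, ← Bool.eq_iff_iff] using this
  · rw [Nat.testBit_lt_two_pow (ha.trans_le (Nat.pow_le_pow_right two_pos hi)),
      Nat.testBit_lt_two_pow (hb.trans_le (Nat.pow_le_pow_right two_pos hi))]

lemma exists_vectorSet_eq {n : ℕ} (S : Set (Fin n → Bool)) :
    ∃ m < 2 ^ 2 ^ n, vectorSet n m = S := by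
  classical
  refine ⟨Nat.ofBits fun c : Fin (2 ^ n) => decide ((fun i : Fin n => c.val.testBit i) ∈ S),
    Nat.ofBits_lt_two_pow _, ?_⟩
  ext v
  rw [mem_vectorSet, Nat.testBit_ofBits_lt _ _ (Nat.ofBits_lt_two_pow v), decide_eq_true_eq]
  simp

lemma card_meetClosed_eq_length (n : ℕ) :
    Nat.card {S : Set (Fin n → Bool) //
        MeetClosed S ∧ (fun _ => false) ∈ S ∧ (fun _ => true) ∈ S} =
      ((closedMasks (2 ^ n)).filter fun m => m.testBit 0 && m.testBit (2 ^ n - 1)).length := by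
  have h₀ : Nat.ofBits (fun _ : Fin n => false) = 0 :=
    Nat.eq_of_testBit_eq fun i => by
      rcases lt_or_ge i n with h | h
      · simp [Nat.testBit_ofBits_lt _ _ h]
      · simp [Nat.testBit_ofBits_ge _ _ h]
  have h₁ : Nat.ofBits (fun _ : Fin n => true) = 2 ^ n - 1 :=
    Nat.eq_of_testBit_eq fun i => by
      rcases lt_or_ge i n with h | h
      · simp [Nat.testBit_ofBits_lt _ _ h, h]
      · simp [Nat.testBit_ofBits_ge _ _ h, h]
  rw [← List.toFinset_card_of_nodup ((nodup_closedMasks _).filter _), ← Set.ncard_coe_finset,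
    ← ((vectorSet_injOn n).mono fun m hm => ?_).ncard_image]
  · change Set.ncard {S : Set (Fin n → Bool) |
      MeetClosed S ∧ (fun _ => false) ∈ S ∧ (fun _ => true) ∈ S} = _
    congr 1
    ext S
    simp only [Set.mem_ofPred_eq, Set.mem_image, SetLike.mem_coe, List.mem_toFinset,
      List.mem_filter, mem_closedMasks, Bool.and_eq_true]
    constructor
    · rintro ⟨hS, hf, ht⟩
      obtain ⟨m, hm, rfl⟩ := exists_vectorSet_eq S
      rw [mem_vectorSet, h₀] at hf
      rw [mem_vectorSet, h₁] at ht
      exact ⟨m, ⟨⟨hm, (meetClosed_vectorSet_iff hm).1 hS⟩, hf, ht⟩, rfl⟩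
    · rintro ⟨m, ⟨⟨hm, hS⟩, hf, ht⟩, rfl⟩
      rw [mem_vectorSet, mem_vectorSet, h₀, h₁]
      exact ⟨(meetClosed_vectorSet_iff hm).2 hS, hf, ht⟩
  · simp only [SetLike.mem_coe, List.mem_toFinset, List.mem_filter, mem_closedMasks] at hm
    exact hm.1.1

theorem H_4_eq :
    Nat.card {S : Set (Fin 4 → Bool) //
        MeetClosed S ∧ (fun _ => false) ∈ S ∧ (fun _ => true) ∈ S} = 2271 := by
  rw [card_meetClosed_eq_length]
  decide +kernel
end

section
/- The number of meet-closed subsets of Fin 3 → Bool containing the all-true vector is 61. (In the paper's notation: H₁(3) = 61, the number of Moore families on a 3-element set.) -/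
/-- A Boolean vector of length three, read as a binary numeral, lowest digit first. -/
def boolVecEquiv : (Fin 3 → Bool) ≃ Fin 8 where
  toFun v := ⟨(v 0).toNat + 2 * (v 1).toNat + 4 * (v 2).toNat, by
    have h₀ := (v 0).toNat_le
    have h₁ := (v 1).toNat_le
    have h₂ := (v 2).toNat_le
    omega⟩
  invFun i k := i.val.testBit k
  left_inv := by decide
  right_inv := by decide

theorem boolVecEquiv_and (v w : Fin 3 → Bool) :
    (boolVecEquiv fun i => v i && w i).val =
      (boolVecEquiv v).val &&& (boolVecEquiv w).val := by
  revert v w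
  decide

/-- The set of Boolean vectors whose codes are the positions of the binary digits 1 of `m`. -/
def maskSet (m : Fin 256) : Set (Fin 3 → Bool) :=
  {v | m.val.testBit (boolVecEquiv v) = true}

theorem mem_maskSet {m : Fin 256} {v : Fin 3 → Bool} :
    v ∈ maskSet m ↔ m.val.testBit (boolVecEquiv v) = true :=
  Iff.rfl

theorem maskSet_injective : Function.Injective maskSet := by
  intro a b h
  refine Fin.ext (Nat.eq_of_testBit_eq fun i => ?_)
  by_cases hi : i < 8
  · have := Set.ext_iff.mp h (boolVecEquiv.symm ⟨i, hi⟩)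
    simp only [mem_maskSet, Equiv.apply_symm_apply] at this
    exact Bool.eq_iff_iff.mpr this
  · have hp : 256 ≤ 2 ^ i := Nat.pow_le_pow_right (n := 2) two_pos (not_lt.mp hi)
    rw [Nat.testBit_lt_two_pow (a.isLt.trans_le hp), Nat.testBit_lt_two_pow (b.isLt.trans_le hp)]

theorem maskSet_bijective : Function.Bijective maskSet := by
  classical
  refine (Fintype.bijective_iff_injective_and_card _).mpr ⟨maskSet_injective, ?_⟩
  simp [Fintype.card_set]

theorem meetClosed_maskSet_iff (m : Fin 256) :
    MeetClosed (maskSet m) ↔ ∀ i < 8, m.val.testBit i = true →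
      ∀ j < 8, m.val.testBit j = true → m.val.testBit (i &&& j) = true := by
  simp only [MeetClosed, mem_maskSet, boolVecEquiv_and]
  constructor
  · intro h i hi hmi j hj hmj
    simpa using h (boolVecEquiv.symm ⟨i, hi⟩) (by simpa using hmi)
      (boolVecEquiv.symm ⟨j, hj⟩) (by simpa using hmj)
  · intro h v hv w hw
    exact h _ (boolVecEquiv v).isLt hv _ (boolVecEquiv w).isLt hw

theorem true_mem_maskSet_iff (m : Fin 256) :
    (fun _ => true) ∈ maskSet m ↔ m.val.testBit 7 = true :=
  Iff.rfl

theorem H1_3_eq :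
    Nat.card {S : Set (Fin 3 → Bool) //
        MeetClosed S ∧ (fun _ => true) ∈ S} = 61 := by
  have e := (Equiv.ofBijective maskSet maskSet_bijective).subtypeEquiv
    (p := fun m => m.val.testBit 7 = true ∧ ∀ i < 8, m.val.testBit i = true →
      ∀ j < 8, m.val.testBit j = true → m.val.testBit (i &&& j) = true)
    (q := fun S => MeetClosed S ∧ (fun _ => true) ∈ S) fun m => by
      rw [Equiv.ofBijective_apply, meetClosed_maskSet_iff, true_mem_maskSet_iff, and_comm]
  rw [← Nat.card_congr e, Nat.card_eq_fintype_card, Fintype.card_subtype]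
  decide +kernel
end
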